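/- Let P be a program. A set M ⊆ at(P) is an answer set of P if and only if M is a model of P and, for every x ∈ M, the atom t_x belongs to every inclusion-minimal model of the program P_x^M ∪ {{x_x} ← ∅} ∪ {{y_x} ← ∅ : y ∈ at(P) \ M}, where P_x^M denotes the reduct of P_x relative to M. -/

import Mathlib

open Classical

noncomputable section

/-- A rule of a disjunctive logic program: head, positive body, negative body. -/
structure Rule (A : Type*) where
  head : Finset A
  bodyP : Finset A
  bodyN : Finset A
  deriving DecidableEq

/-- A program is a finite set of rules. -/
abbrev Program (A : Type*) := Finset (Rule A)

variable {A : Type*} [DecidableEq A]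

/-- The atoms occurring in a program. -/
def atoms (P : Program A) : Finset A := P.sup (fun r => r.head ∪ r.bodyP ∪ r.bodyN)

/-- An interpretation `I` satisfies a rule `r` iff `(H(r) ∪ B⁻(r)) ∩ I ≠ ∅` or `B⁺(r) \ I ≠ ∅`. -/
def satR (I : Set A) (r : Rule A) : Prop :=
  (∃ a ∈ r.head ∪ r.bodyN, a ∈ I) ∨ (∃ a ∈ r.bodyP, a ∉ I)

/-- `I` is a model of `P` iff it satisfies every rule of `P`. -/
def isModel (I : Set A) (P : Program A) : Prop := ∀ r ∈ P, satR I r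

/-- The Gelfond-Lifschitz reduct `P^I`. -/
def reduct (P : Program A) (I : Set A) : Program A :=
  (P.filter (fun r => ∀ a ∈ r.bodyN, a ∉ I)).image (fun r => ⟨r.head, r.bodyP, ∅⟩)

/-- `I` is an inclusion-minimal model of `P`. -/
def isMinModel (I : Set A) (P : Program A) : Prop :=
  isModel I P ∧ ∀ J ⊆ I, isModel J P → J = I

/-- `I` is an answer set of `P` iff `I` is a minimal model of the reduct `P^I`. -/
def isAnswerSet (I : Set A) (P : Program A) : Prop := isMinModel I (reduct P I)

/-- The collection of answer sets of `P`. -/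
def AS (P : Program A) : Set (Set A) := {M | isAnswerSet M P}

/-- Dual-Horn: every rule has at most one positive body atom and empty negative body. -/
def dualHorn (P : Program A) : Prop := ∀ r ∈ P, r.bodyP.card ≤ 1 ∧ r.bodyN = ∅

/-- Dual-normal: every rule is a constraint or has at most one positive body atom. -/
def dualNormal (P : Program A) : Prop := ∀ r ∈ P, r.head = ∅ ∨ r.bodyP.card ≤ 1

/-- Normal: every rule has at most one head atom. -/
def normal (P : Program A) : Prop := ∀ r ∈ P, r.head.card ≤ 1

/-- The proper rules (non-constraints) of `P`. -/
def properPart (P : Program A) : Program A := P.filter (fun r => r.head ≠ ∅)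

/-- The constraints of `P`. -/
def constraintPart (P : Program A) : Program A := P.filter (fun r => r.head = ∅)

/-- `P[t]`: replace each rule with empty positive body by one whose positive body is `{t}`. -/
def progT (P : Program A) (t : A) : Program A :=
  P.image (fun r => if r.bodyP = ∅ then ⟨r.head, {t}, r.bodyN⟩ else r)

/-- The elimination sets `E_i` computed from `P[t]` (for `P` dual-Horn). -/
def E (P : Program A) (t : A) : ℕ → Set A
  | 0 => ∅
  | (i+1) => {b | ∃ r ∈ progT P t, r.bodyP = {b} ∧ ↑r.head ⊆ E P t i}

/-- The program `P_{M,m}`. -/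
def pmm (P : Program A) (M : Set A) (m : A) : Program A :=
  reduct (properPart P) M ∪
    ((atoms P).filter (fun b => b ∉ M)).image (fun b => ⟨∅, {b}, ∅⟩) ∪
    {⟨∅, {m}, ∅⟩}

/- Atoms of the translated program: `Sum.inl a` is the original atom `a`,
`Sum.inr (Sum.inl x)` is the fresh atom `x̄`, and `Sum.inr (Sum.inr (y?, x))` is the fresh
atom `y_x` (with `y? = some y`) resp. `t_x` (with `y? = none`). -/
abbrev TA (A : Type*) := A ⊕ (A ⊕ (Option A × A))

/-- The original atom `a`. -/
def orig (a : A) : TA A := Sum.inl a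

/-- The fresh atom `x̄`. -/
def bar (x : A) : TA A := Sum.inr (Sum.inl x)

/-- The fresh atom `y_x` (`sub (some y) x`) resp. `t_x` (`sub none x`). -/
def sub (y : Option A) (x : A) : TA A := Sum.inr (Sum.inr (y, x))

/-- The program `P_x = { B⁺(r)_x ← H(r)_x, not B⁻(r) : r ∈ (P_r)[t] }`:
heads and positive bodies of the rules of `(P_r)[t]` are swapped and their atoms renamed
with subscript `x`; negative bodies keep the original atoms. -/
def Px (P : Program A) (x : A) : Program (TA A) :=
  (properPart P).image (fun r =>
    ⟨if r.bodyP = ∅ then {sub none x} else r.bodyP.image (fun y => sub (some y) x),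
     r.head.image (fun y => sub (some y) x),
     r.bodyN.image orig⟩)

/-- `P_xor = { {x} ← ∅, not {x̄} ; {x̄} ← ∅, not {x} : x ∈ at(P) }`. -/
def Pxor (P : Program A) : Program (TA A) :=
  (atoms P).image (fun x => ⟨{orig x}, ∅, {bar x}⟩) ∪
  (atoms P).image (fun x => ⟨{bar x}, ∅, {orig x}⟩)

/-- `P_aux = { {x_x} ← ∅, not {x̄} : x ∈ at(P) } ∪ { {y_x} ← ∅, not {x̄, y} : x, y ∈ at(P) }`. -/
def Paux (P : Program A) : Program (TA A) :=
  (atoms P).image (fun x => ⟨{sub (some x) x}, ∅, {bar x}⟩) ∪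
  ((atoms P) ×ˢ (atoms P)).image (fun p => ⟨{sub (some p.2) p.1}, ∅, {bar p.1, orig p.2}⟩)

/-- `P_diag = P_xor ∪ P_aux ∪ ⋃_{x ∈ at(P)} P_x`. -/
def Pdiag (P : Program A) : Program (TA A) :=
  Pxor P ∪ Paux P ∪ (atoms P).biUnion (fun x => Px P x)

/-- `P_mod = { ∅ ← B⁺(r), not (H(r) ∪ B⁻(r)) : r ∈ P }`. -/
def Pmod (P : Program A) : Program (TA A) :=
  P.image (fun r => ⟨∅, r.bodyP.image orig, (r.head ∪ r.bodyN).image orig⟩)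

/-- `P_true = { ∅ ← {x}, not {t_x} : x ∈ at(P) }`. -/
def Ptrue (P : Program A) : Program (TA A) :=
  (atoms P).image (fun x => ⟨∅, {orig x}, {sub none x}⟩)

/-- The translated program `P_trans = P_diag ∪ P_mod ∪ P_true`. -/
def Ptrans (P : Program A) : Program (TA A) := Pdiag P ∪ Pmod P ∪ Ptrue P

/-- The program `P_x^M ∪ {{x_x} ← ∅} ∪ {{y_x} ← ∅ : y ∈ at(P) \ M}`, where the reduct
of `P_x` is taken relative to `M` (whose atoms are original atoms). -/
def PxM (P : Program A) (M : Set A) (x : A) : Program (TA A) :=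
  reduct (Px P x) (orig '' M) ∪ {⟨{sub (some x) x}, ∅, ∅⟩} ∪
    ((atoms P).filter (fun y => y ∉ M)).image (fun y => ⟨{sub (some y) x}, ∅, ∅⟩)

theorem mem_atoms_of_rule {A : Type*} [DecidableEq A] {P : Program A} {r : Rule A} (hr : r ∈ P)
    {a : A} (ha : a ∈ r.head ∨ a ∈ r.bodyP) : a ∈ atoms P := by
  unfold atoms
  rw [Finset.mem_sup]
  refine ⟨r, hr, ?_⟩
  simp only [Finset.mem_union]
  tauto

theorem isModel_reduct_iff {A : Type*} [DecidableEq A] (P : Program A) (M J : Set A) :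
    isModel J (reduct P M) ↔ ∀ r ∈ P, (∀ a ∈ r.bodyN, a ∉ M) →
      ((∃ a ∈ r.head, a ∈ J) ∨ ∃ a ∈ r.bodyP, a ∉ J) := by
  unfold isModel reduct
  constructor
  · intro h r hr hn
    have := h ⟨r.head, r.bodyP, ∅⟩
      (Finset.mem_image.2 ⟨r, Finset.mem_filter.2 ⟨hr, hn⟩, rfl⟩)
    simpa [satR] using this
  · intro h r hr
    obtain ⟨s, hs, rfl⟩ := Finset.mem_image.1 hr
    obtain ⟨hs, hn⟩ := Finset.mem_filter.1 hs
    simpa [satR] using h s hs hn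

theorem isModel_PxM_iff {A : Type*} [DecidableEq A] (P : Program A) (M : Set A) (x : A)
    (N : Set (TA A)) :
    isModel N (PxM P M x) ↔
      (∀ r ∈ P, r.head ≠ ∅ → (∀ a ∈ r.bodyN, a ∉ M) →
        ((r.bodyP = ∅ ∧ sub none x ∈ N) ∨ (∃ a ∈ r.bodyP, sub (some a) x ∈ N) ∨
          ∃ a ∈ r.head, sub (some a) x ∉ N)) ∧
      sub (some x) x ∈ N ∧ ∀ y ∈ atoms P, y ∉ M → sub (some y) x ∈ N := by
  have key : isModel N (PxM P M x) ↔ isModel N (reduct (Px P x) (orig '' M)) ∧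
      sub (some x) x ∈ N ∧ ∀ y ∈ atoms P, y ∉ M → sub (some y) x ∈ N := by
    unfold PxM isModel
    constructor
    · intro h
      refine ⟨fun r hr => h r (by simp [hr]), ?_, fun y hy hyM => ?_⟩
      · have := h ⟨{sub (some x) x}, ∅, ∅⟩ (by simp)
        simpa [satR] using this
      · have := h ⟨{sub (some y) x}, ∅, ∅⟩
          (Finset.mem_union_right _ (Finset.mem_image.2 ⟨y, Finset.mem_filter.2 ⟨hy, hyM⟩, rfl⟩))
        simpa [satR] using this
    · rintro ⟨h1, h2, h3⟩ r hr
      rcases Finset.mem_union.1 hr with hr | hr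
      · rcases Finset.mem_union.1 hr with hr | hr
        · exact h1 r hr
        · rw [Finset.mem_singleton.1 hr]
          simpa [satR] using h2
      · obtain ⟨y, hy, rfl⟩ := Finset.mem_image.1 hr
        obtain ⟨hy, hyM⟩ := Finset.mem_filter.1 hy
        simpa [satR] using h3 y hy hyM
  rw [key, isModel_reduct_iff]
  refine and_congr ?_ Iff.rfl
  unfold Px properPart
  rw [Finset.forall_mem_image]
  constructor
  · intro h r hr hh hn
    have := h (Finset.mem_filter.2 ⟨hr, hh⟩) (by
      intro a ha
      obtain ⟨b, hb, rfl⟩ := Finset.mem_image.1 ha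
      rintro ⟨c, hc, hcb⟩
      exact hn b hb (Sum.inl_injective hcb ▸ hc))
    by_cases hb : r.bodyP = ∅
    · simpa [hb] using this
    · simpa [hb] using this
  · intro h r hr hn
    obtain ⟨hr, hh⟩ := Finset.mem_filter.1 hr
    have := h r hr hh (fun a ha haM => hn (orig a) (Finset.mem_image_of_mem _ ha) ⟨a, haM, rfl⟩)
    by_cases hb : r.bodyP = ∅
    · simpa [hb] using this
    · simpa [hb] using this

theorem exists_isMinModel {A : Type*} [DecidableEq A] (P : Program A) (N : Set A)
    (hf : N.Finite) (hN : isModel N P) : ∃ K ⊆ N, isMinModel K P := by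
  obtain ⟨K, hK, hmin⟩ := Set.Finite.exists_minimal (s := {K | K ⊆ N ∧ isModel K P})
    (hf.finite_subsets.subset (fun K h => h.1)) ⟨N, subset_rfl, hN⟩
  exact ⟨K, hK.1, hK.2, fun J hJ hm =>
    subset_antisymm hJ (hmin ⟨hJ.trans hK.1, hm⟩ hJ)⟩

/-- `M ⊆ at(P)` is an answer set of `P` iff `M` is a model of `P` and,
for every `x ∈ M`, the atom `t_x` belongs to every inclusion-minimal model of
`P_x^M ∪ {{x_x} ← ∅} ∪ {{y_x} ← ∅ : y ∈ at(P) \ M}`. -/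
theorem answerSet_iff_tx_in_minModels (P : Program A) (M : Set A) (hM : M ⊆ ↑(atoms P)) :
    isAnswerSet M P ↔
      (isModel M P ∧
       ∀ x ∈ M, ∀ N : Set (TA A), isMinModel N (PxM P M x) → sub none x ∈ N) := by
  have hmod : isModel M (reduct P M) ↔ isModel M P := by
    rw [isModel_reduct_iff]
    unfold isModel satR
    refine forall₂_congr fun r hr => ?_
    simp only [Finset.mem_union]
    grind
  unfold isAnswerSet isMinModel
  rw [hmod]
  refine and_congr_right fun hMP => ⟨?_, ?_⟩
  · intro hmin x hx N hN
    by_contra ht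
    obtain ⟨h1, h2, h3⟩ := (isModel_PxM_iff P M x N).1 hN.1
    have hJ : {y | y ∈ M ∧ sub (some y) x ∉ N} = M := by
      refine hmin _ (fun y hy => hy.1) ?_
      rw [isModel_reduct_iff]
      intro r hr hn
      by_cases hh : r.head = ∅
      · rcases (isModel_reduct_iff P M M).1 (hmod.2 hMP) r hr hn with ⟨a, ha, -⟩ | ⟨a, ha, haM⟩
        · simp [hh] at ha
        · exact Or.inr ⟨a, ha, fun h => haM h.1⟩
      · rcases h1 r hr hh hn with ⟨-, h⟩ | ⟨a, ha, haN⟩ | ⟨a, ha, haN⟩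
        · exact absurd h ht
        · exact Or.inr ⟨a, ha, fun h => h.2 haN⟩
        · refine Or.inl ⟨a, ha, ?_, haN⟩
          by_contra haM
          exact haN (h3 a (mem_atoms_of_rule hr (Or.inl ha)) haM)
    rw [← hJ] at hx
    exact hx.2 h2
  · intro h J hJM hJ
    refine subset_antisymm hJM fun x hx => ?_
    by_contra hxJ
    rw [isModel_reduct_iff] at hJ
    have hsub : ∀ a, sub (some a) x ∈ (fun y => sub (some y) x) '' (↑(atoms P) \ J : Set A) ↔
        a ∈ atoms P ∧ a ∉ J := by
      intro a
      simp [sub]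
    obtain ⟨K, hKN, hK⟩ := exists_isMinModel (PxM P M x)
      ((fun y => sub (some y) x) '' (↑(atoms P) \ J : Set A))
      ((Set.Finite.subset (atoms P).finite_toSet Set.diff_subset).image _) (by
        rw [isModel_PxM_iff]
        simp only [hsub]
        refine ⟨fun r hr hh hn => ?_, ⟨hM hx, hxJ⟩, fun y hy hyM => ⟨hy, fun h => hyM (hJM h)⟩⟩
        rcases hJ r hr hn with ⟨a, ha, haJ⟩ | ⟨a, ha, haJ⟩
        · exact Or.inr (Or.inr ⟨a, ha, fun h => h.2 haJ⟩)
        · exact Or.inr (Or.inl ⟨a, ha, mem_atoms_of_rule hr (Or.inr ha), haJ⟩))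
    obtain ⟨y, -, hy⟩ := hKN (h x hx K hK)
    simp [sub] at hy
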